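/- arXiv:2104.06949 — 12 statements merged into one kernel-verified Lean document; each statement's English description precedes it below -/
import Mathlib

section
/- Let λ ∈ ℝ with λ ≠ 2 and let σ : [0,1] → ℝ be continuous. Then the boundary value problem u''(t) + σ(t) = 0 for 0 < t < 1, u(0) = 0, u(1) = λ∫₀¹ u(s) ds, has a unique solution u of class C² on [0,1], and it is given by u(t) = ∫₀¹ G(t,s) σ(s) ds. -/
open Set

/-- Green's function for `u'' + σ = 0`, `u(0)=0`, `u(1)=λ∫₀¹u`. -/
noncomputable def G (lam t s : ℝ) : ℝ :=
  if s ≤ t then (t * (1 - s) * (2 - lam + lam * s) - (2 - lam) * (t - s)) / (2 - lam)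
  else t * (1 - s) * (2 - lam + lam * s) / (2 - lam)

lemma affine_aux (f : ℝ → ℝ) (hf : ContDiffOn ℝ 2 f (Icc 0 1))
    (h : ∀ t ∈ Ioo (0:ℝ) 1, deriv (deriv f) t = 0) :
    ∃ a b : ℝ, ∀ t ∈ Icc (0:ℝ) 1, f t = a * t + b := by
  have hf2 : ContDiffOn ℝ 2 f (Ioo 0 1) := hf.mono Ioo_subset_Icc_self
  have hd1 : DifferentiableOn ℝ f (Ioo 0 1) := hf2.differentiableOn (by norm_num)
  have hd2 : DifferentiableOn ℝ (deriv f) (Ioo 0 1) := by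
    have : ContDiffOn ℝ 1 (deriv f) (Ioo 0 1) :=
      hf2.deriv_of_isOpen isOpen_Ioo (by norm_num)
    exact this.differentiableOn (by norm_num)
  obtain ⟨a, ha⟩ := isOpen_Ioo.exists_is_const_of_deriv_eq_zero
    (isPreconnected_Ioo) hd2 (fun t ht => h t ht)
  have hd3 : DifferentiableOn ℝ (fun t => f t - a * t) (Ioo 0 1) :=
    hd1.sub (by fun_prop)
  obtain ⟨b, hb⟩ := isOpen_Ioo.exists_is_const_of_deriv_eq_zero
    (isPreconnected_Ioo) hd3 (fun t ht => by
      have h1 : HasDerivAt f a t := by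
        rw [← ha t ht]
        exact ((hd1 t ht).differentiableAt (isOpen_Ioo.mem_nhds ht)).hasDerivAt
      have h2 : HasDerivAt (fun t => f t - a * t) (a - a * 1) t :=
        h1.sub ((hasDerivAt_id t).const_mul a)
      rw [h2.deriv]; simp)
  refine ⟨a, b, ?_⟩
  have e : EqOn f (fun t => a * t + b) (Ioo 0 1) := fun t ht => by
    have := hb t ht
    simp only at this ⊢
    linarith
  have := e.of_subset_closure hf.continuousOn (by fun_prop) Ioo_subset_Icc_self
    (by rw [closure_Ioo (by norm_num)])
  exact this

lemma G_eq (lam t s : ℝ) (hlam : lam ≠ 2) :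
    G lam t s = t * (1 - s) * (2 - lam + lam * s) / (2 - lam) - max (t - s) 0 := by
  have h : 2 - lam ≠ 0 := sub_ne_zero.mpr hlam.symm
  unfold G
  split_ifs with hs
  · rw [max_eq_left (by linarith)]; field_simp
  · rw [max_eq_right (by linarith)]; simp

theorem stmt_0 (lam : ℝ) (hlam : lam ≠ 2) (σ : ℝ → ℝ)
    (hσ : ContinuousOn σ (Icc 0 1)) :
    ∃ u : ℝ → ℝ,
      (ContDiffOn ℝ 2 u (Icc 0 1) ∧
        (∀ t ∈ Ioo (0:ℝ) 1, deriv (deriv u) t + σ t = 0) ∧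
        u 0 = 0 ∧ u 1 = lam * ∫ s in (0:ℝ)..1, u s) ∧
      (∀ t ∈ Icc (0:ℝ) 1, u t = ∫ s in (0:ℝ)..1, G lam t s * σ s) ∧
      (∀ v : ℝ → ℝ,
        (ContDiffOn ℝ 2 v (Icc 0 1) ∧
          (∀ t ∈ Ioo (0:ℝ) 1, deriv (deriv v) t + σ t = 0) ∧
          v 0 = 0 ∧ v 1 = lam * ∫ s in (0:ℝ)..1, v s) →
        EqOn v u (Icc 0 1)) := by
  have hl : 2 - lam ≠ 0 := sub_ne_zero.mpr hlam.symm
  obtain ⟨τ, hτ, hτσ⟩ : ∃ τ : ℝ → ℝ, Continuous τ ∧ ∀ t ∈ Icc (0:ℝ) 1, τ t = σ t :=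
    ⟨IccExtend zero_le_one ((Icc (0:ℝ) 1).domRestrict σ), hσ.domRestrict.Icc_extend',
      fun t ht => by rw [IccExtend_of_mem _ _ ht]; rfl⟩
  have prim : ∀ f : ℝ → ℝ, Continuous f → ∀ t, HasDerivAt (fun x => ∫ s in (0:ℝ)..x, f s) (f t) t :=
    fun f hf t => hf.integral_hasStrictDerivAt 0 t |>.hasDerivAt
  obtain ⟨S, hSdef⟩ : ∃ S : ℝ → ℝ, S = fun x => ∫ s in (0:ℝ)..x, τ s := ⟨_, rfl⟩
  obtain ⟨R, hRdef⟩ : ∃ S : ℝ → ℝ, S = fun x => ∫ s in (0:ℝ)..x, s * τ s := ⟨_, rfl⟩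
  obtain ⟨T, hTdef⟩ : ∃ S : ℝ → ℝ, S = fun x => ∫ s in (0:ℝ)..x, s ^ 2 * τ s := ⟨_, rfl⟩
  have hS : ∀ t, HasDerivAt S (τ t) t := by rw [hSdef]; exact prim _ hτ
  have hR : ∀ t, HasDerivAt R (t * τ t) t := by rw [hRdef]; exact prim _ (by fun_prop)
  have hT : ∀ t, HasDerivAt T (t ^ 2 * τ t) t := by rw [hTdef]; exact prim _ (by fun_prop)
  have S0 : S 0 = 0 := by simp [hSdef]
  have R0 : R 0 = 0 := by simp [hRdef]
  have T0 : T 0 = 0 := by simp [hTdef]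
  obtain ⟨c, hc⟩ : ∃ c : ℝ, c = ((2 - lam) * S 1 + (2 * lam - 2) * R 1 - lam * T 1) / (2 - lam) :=
    ⟨_, rfl⟩
  obtain ⟨u, hu⟩ : ∃ u : ℝ → ℝ, u = fun t => c * t - (t * S t - R t) := ⟨_, rfl⟩
  have hu1 : ∀ t, HasDerivAt u (c - S t) t := fun t => by
    rw [hu]
    have := ((hasDerivAt_id t).const_mul c).sub (((hasDerivAt_id t).mul (hS t)).sub (hR t))
    refine this.congr_deriv ?_
    simp only [id]; ring
  have hdu : deriv u = fun t => c - S t := funext fun t => (hu1 t).deriv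
  have hu2 : ∀ t, HasDerivAt (deriv u) (-τ t) t := fun t => by
    rw [hdu]; exact (hS t).const_sub c
  have huC : ContDiff ℝ 2 u := by
    have : ContDiff ℝ (1 + 1) u := by
      rw [contDiff_succ_iff_deriv]
      refine ⟨fun t => (hu1 t).differentiableAt, by simp, ?_⟩
      rw [contDiff_one_iff_deriv]
      refine ⟨fun t => (hu2 t).differentiableAt, ?_⟩
      rw [funext fun t => (hu2 t).deriv]
      exact hτ.neg
    simpa [one_add_one_eq_two] using this
  have hint : ∫ s in (0:ℝ)..1, u s = c / 2 - (S 1 / 2 - R 1 + T 1 / 2) := by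
    rw [intervalIntegral.integral_eq_sub_of_hasDerivAt
      (f := fun t => c * t ^ 2 / 2 - (t ^ 2 * S t / 2 - t * R t + T t / 2))]
    · simp [S0, R0, T0]
    · intro t _
      have h2 : HasDerivAt (fun t : ℝ => t ^ 2) (2 * t) t := by simpa using hasDerivAt_pow 2 t
      have := ((h2.const_mul c).div_const 2).sub
        ((((h2.mul (hS t)).div_const 2).sub ((hasDerivAt_id t).mul (hR t))).add ((hT t).div_const 2))
      refine this.congr_deriv ?_
      simp only [hu, id]; ring
    · exact huC.continuous.intervalIntegrable _ _
  have hu0 : u 0 = 0 := by simp [hu, R0]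
  have hub : u 1 = lam * ∫ s in (0:ℝ)..1, u s := by
    rw [hint, hu, hc]; field_simp; ring
  have hudd : ∀ t ∈ Ioo (0:ℝ) 1, deriv (deriv u) t + σ t = 0 := fun t ht => by
    rw [(hu2 t).deriv, hτσ t (Ioo_subset_Icc_self ht)]; ring
  refine ⟨u, ⟨huC.contDiffOn, hudd, hu0, hub⟩, ?_, ?_⟩
  · intro t ht
    have e1 : ∫ s in (0:ℝ)..1, G lam t s * σ s =
        ∫ s in (0:ℝ)..1, ((t * τ s + t * (2 * lam - 2) / (2 - lam) * (s * τ s)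
          - t * lam / (2 - lam) * (s ^ 2 * τ s)) - max (t - s) 0 * τ s) := by
      apply intervalIntegral.integral_congr
      intro s hs
      rw [uIcc_of_le zero_le_one] at hs
      simp only
      rw [G_eq _ _ _ hlam, hτσ s hs]
      field_simp; ring
    have e2 : ∫ s in (0:ℝ)..1, max (t - s) 0 * τ s = t * S t - R t := by
      have hcm : Continuous fun s => max (t - s) 0 * τ s := by fun_prop
      rw [← intervalIntegral.integral_add_adjacent_intervals
        (hcm.intervalIntegrable 0 t) (hcm.intervalIntegrable t 1)]
      have a1 : ∫ s in (0:ℝ)..t, max (t - s) 0 * τ s = ∫ s in (0:ℝ)..t, (t * τ s - s * τ s) := by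
        apply intervalIntegral.integral_congr
        intro s hs
        rw [uIcc_of_le ht.1] at hs
        simp only
        rw [max_eq_left (by linarith [hs.2])]; ring
      have a2 : ∫ s in t..1, max (t - s) 0 * τ s = ∫ s in t..1, (0:ℝ) := by
        apply intervalIntegral.integral_congr
        intro s hs
        rw [uIcc_of_le ht.2] at hs
        simp only
        rw [max_eq_right (by linarith [hs.1])]; ring
      rw [a1, a2, intervalIntegral.integral_sub
        (Continuous.intervalIntegrable (by fun_prop) _ _)
        (Continuous.intervalIntegrable (by fun_prop) _ _), intervalIntegral.integral_const_mul]
      simp [hSdef, hRdef]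
    rw [e1, intervalIntegral.integral_sub
        (Continuous.intervalIntegrable (by fun_prop) _ _)
        (Continuous.intervalIntegrable (by fun_prop) _ _), e2,
      intervalIntegral.integral_sub
        (Continuous.intervalIntegrable (by fun_prop) _ _)
        (Continuous.intervalIntegrable (by fun_prop) _ _),
      intervalIntegral.integral_add
        (Continuous.intervalIntegrable (by fun_prop) _ _)
        (Continuous.intervalIntegrable (by fun_prop) _ _),
      intervalIntegral.integral_const_mul, intervalIntegral.integral_const_mul,
      intervalIntegral.integral_const_mul]
    have s1 : ∫ s in (0:ℝ)..1, τ s = S 1 := by rw [hSdef]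
    have r1 : ∫ s in (0:ℝ)..1, s * τ s = R 1 := by rw [hRdef]
    have t1 : ∫ s in (0:ℝ)..1, s ^ 2 * τ s = T 1 := by rw [hTdef]
    rw [s1, r1, t1, hu, hc]
    field_simp
  · rintro v ⟨hv, hvdd, hv0, hvb⟩
    have hv2 : ContDiffOn ℝ 2 v (Ioo 0 1) := hv.mono Ioo_subset_Icc_self
    have hvd : DifferentiableOn ℝ v (Ioo 0 1) := hv2.differentiableOn (by norm_num)
    have hvd2 : DifferentiableOn ℝ (deriv v) (Ioo 0 1) :=
      (hv2.deriv_of_isOpen (m := 1) isOpen_Ioo (by norm_num)).differentiableOn (by norm_num)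
    obtain ⟨a, b, hab⟩ := affine_aux (fun t => v t - u t) (hv.sub huC.contDiffOn) (fun t ht => by
      have hn := isOpen_Ioo.mem_nhds ht
      have e : deriv (fun t => v t - u t) =ᶠ[nhds t] fun t => deriv v t - deriv u t := by
        filter_upwards [hn] with x hx
        exact (((hvd x hx).differentiableAt (isOpen_Ioo.mem_nhds hx)).hasDerivAt.sub
          (hu1 x).differentiableAt.hasDerivAt).deriv
      rw [e.deriv_eq]
      have h3 : deriv (fun t => deriv v t - deriv u t) t = deriv (deriv v) t - deriv (deriv u) t :=
        (((hvd2 t ht).differentiableAt hn).hasDerivAt.sub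
          (hu2 t).differentiableAt.hasDerivAt).deriv
      rw [h3]
      linarith [hvdd t ht, hudd t ht])
    have hb : b = 0 := by
      have := hab 0 (by simp)
      simp only [hv0, hu0] at this
      linarith
    subst hb
    have hvi : ∫ s in (0:ℝ)..1, v s = (∫ s in (0:ℝ)..1, u s) + a / 2 := by
      have : ∫ s in (0:ℝ)..1, v s = ∫ s in (0:ℝ)..1, (u s + a * s) := by
        apply intervalIntegral.integral_congr
        intro s hs
        rw [uIcc_of_le zero_le_one] at hs
        have := hab s hs
        simp only at this ⊢
        linarith
      rw [this, intervalIntegral.integral_add (huC.continuous.intervalIntegrable _ _)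
        (Continuous.intervalIntegrable (by fun_prop) _ _), intervalIntegral.integral_const_mul,
        integral_id]
      ring
    have ha : a = 0 := by
      have := hab 1 (by simp)
      rw [hvb, hub, hvi] at this
      have h4 : (2 - lam) * a = 0 := by linarith
      exact (mul_eq_zero.mp h4).resolve_left hl
    intro t ht
    have := hab t ht
    simp only [ha] at this
    linarith
end

section
/- Let λ ∈ ℝ with λ ≠ 2. Then G(t,s) > 0 for all t, s ∈ (0,1) if and only if 0 ≤ λ < 2. -/
open Set

theorem stmt_4 (lam : ℝ) (hlam : lam ≠ 2) :
    (∀ t ∈ Ioo (0:ℝ) 1, ∀ s ∈ Ioo (0:ℝ) 1, G lam t s > 0) ↔ (0 ≤ lam ∧ lam < 2) := by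
  constructor
  · intro h
    have h2 : lam < 2 := by
      by_contra hc
      have hl : 2 < lam := lt_of_le_of_ne (not_lt.mp hc) hlam.symm
      have hi : 0 < 1 / lam := by positivity
      have hi2 : 1 / lam < 1 := by rw [div_lt_one (by linarith)]; linarith
      have hm : lam * (1 / lam) = 1 := by field_simp
      generalize 1 / lam = e at *
      have hs : (1 - e) ∈ Ioo (0:ℝ) 1 := ⟨by linarith, by linarith⟩
      have h3 := h (1 - e) hs (1 - e) hs
      unfold G at h3
      rw [if_pos le_rfl] at h3
      have h4 : ((1 - e) * (1 - (1 - e)) * (2 - lam + lam * (1 - e))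
          - (2 - lam) * ((1 - e) - (1 - e))) = (1 - e) * e := by
        linear_combination (-(1 - e) * e) * hm
      rw [h4] at h3
      have h5 : (1 - e) * e / (2 - lam) < 0 :=
        div_neg_of_pos_of_neg (mul_pos (by linarith) hi) (by linarith)
      linarith
    refine ⟨?_, h2⟩
    by_contra hc
    have hl : lam < 0 := not_le.mp hc
    have hd : 0 < 4 - 3 * lam := by linarith
    have hi : 0 < -lam / (4 - 3 * lam) := div_pos (by linarith) hd
    have hi2 : -lam / (4 - 3 * lam) < 1 / 2 := by
      rw [div_lt_iff₀ hd]; linarith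
    have hm : (4 - 3 * lam) * (-lam / (4 - 3 * lam)) = -lam := by field_simp
    generalize -lam / (4 - 3 * lam) = e at *
    have h3 := h (1 - e) ⟨by linarith, by linarith⟩ (1 / 2) ⟨by norm_num, by norm_num⟩
    unfold G at h3
    rw [if_pos (by linarith)] at h3
    have h4 : ((1 - e) * (1 - 1 / 2) * (2 - lam + lam * (1 / 2))
          - (2 - lam) * ((1 - e) - 1 / 2)) = 0 := by
      linear_combination (1 / 4) * hm
    rw [h4] at h3
    simp at h3
  · rintro ⟨h0, h2⟩ t ⟨ht0, ht1⟩ s ⟨hs0, hs1⟩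
    have hd : 0 < 2 - lam := by linarith
    have a : 0 < 1 - t := by linarith
    have b : 0 < 1 - s := by linarith
    unfold G
    split_ifs
    · apply div_pos _ hd
      have : t * (1 - s) * (2 - lam + lam * s) - (2 - lam) * (t - s)
        = s * ((2 - lam) * (1 - t) + lam * t * (1 - s)) := by ring
      rw [this]
      positivity
    · positivity
end

section
/- Let λ ∈ ℝ with λ ≠ 2 and λ ∉ [0,2). Then G changes sign on (0,1) × (0,1); that is, there exist points (t₁,s₁), (t₂,s₂) ∈ (0,1) × (0,1) with G(t₁,s₁) > 0 and G(t₂,s₂) < 0. -/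
open Set

theorem stmt_5 (lam : ℝ) (hlam : lam ≠ 2) (hlam' : lam ∉ Ico (0:ℝ) 2) :
    (∃ t₁ ∈ Ioo (0:ℝ) 1, ∃ s₁ ∈ Ioo (0:ℝ) 1, G lam t₁ s₁ > 0) ∧
    (∃ t₂ ∈ Ioo (0:ℝ) 1, ∃ s₂ ∈ Ioo (0:ℝ) 1, G lam t₂ s₂ < 0) := by
  rcases lt_or_ge lam 0 with h | h
  · have h2 : 0 < 2 - lam := by linarith
    have h3 : 0 < 2 * (4 - 3 * lam) := by linarith
    constructor
    · refine ⟨1/4, by norm_num, 1/2, by norm_num, ?_⟩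
      rw [G, if_neg (by norm_num)]
      apply div_pos _ h2
      nlinarith
    · have ht : 1/2 < (8 - 5 * lam) / (2 * (4 - 3 * lam)) := by
        rw [lt_div_iff₀ h3]; linarith
      have ht1 : (8 - 5 * lam) / (2 * (4 - 3 * lam)) < 1 := by
        rw [div_lt_one h3]; linarith
      have he : (8 - 5 * lam) / (2 * (4 - 3 * lam)) * (2 * (4 - 3 * lam)) = 8 - 5 * lam :=
        div_mul_cancel₀ _ h3.ne'
      generalize (8 - 5 * lam) / (2 * (4 - 3 * lam)) = t at *
      refine ⟨t, ⟨by linarith, ht1⟩, 1/2, by norm_num, ?_⟩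
      rw [G, if_pos ht.le]
      apply div_neg_of_neg_of_pos _ h2
      nlinarith
  · have h2 : 2 < lam := by
      by_contra hc
      exact hlam' ⟨h, lt_of_le_of_ne (not_lt.mp hc) hlam⟩
    have h0 : 0 < lam := by linarith
    have h4 : 2 - lam < 0 := by linarith
    constructor
    · have hs : 0 < (lam - 2) / (2 * lam) := div_pos (by linarith) (by linarith)
      have hs1 : (lam - 2) / (2 * lam) < 1 := by
        rw [div_lt_one (by linarith)]; linarith
      have he : lam * ((lam - 2) / (2 * lam)) = (lam - 2) / 2 := by field_simp
      generalize (lam - 2) / (2 * lam) = s at *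
      refine ⟨s / 2, ⟨by linarith, by linarith⟩, s, ⟨hs, hs1⟩, ?_⟩
      rw [G, if_neg (by linarith), he]
      apply div_pos_of_neg_of_neg _ h4
      exact mul_neg_of_pos_of_neg (mul_pos (by linarith) (by linarith)) (by linarith)
    · have hs : 0 < (lam - 1) / lam := div_pos (by linarith) (by linarith)
      have hs1 : (lam - 1) / lam < 1 := by
        rw [div_lt_one (by linarith)]; linarith
      have he : lam * ((lam - 1) / lam) = lam - 1 := by field_simp
      generalize (lam - 1) / lam = s at *
      refine ⟨s / 2, ⟨by linarith, by linarith⟩, s, ⟨hs, hs1⟩, ?_⟩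
      rw [G, if_neg (by linarith), he]
      apply div_neg_of_pos_of_neg _ h4
      exact mul_pos (mul_pos (by linarith) (by linarith)) (by linarith)
end

section
/- Let λ ∈ [0,2). Then G(t,s) ≤ 1/(2(2−λ)) for all t, s ∈ [0,1]. -/
open Set

theorem stmt_6 (lam : ℝ) (hlam : lam ∈ Ico (0:ℝ) 2) :
    ∀ t ∈ Icc (0:ℝ) 1, ∀ s ∈ Icc (0:ℝ) 1, G lam t s ≤ 1 / (2 * (2 - lam)) := by
  obtain ⟨h0, h2⟩ := hlam
  rintro t ⟨ht0, ht1⟩ s ⟨hs0, hs1⟩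
  have hp : 0 < 2 - lam := by linarith
  have hs : 0 ≤ s * (1 - s) := mul_nonneg hs0 (by linarith)
  have hq : s * (1 - s) ≤ 1 / 4 := by nlinarith [sq_nonneg (s - 1 / 2)]
  have hd : 2 - lam + lam * s ≤ 2 := by nlinarith
  have hd0 : 0 ≤ 2 - lam + lam * s := by nlinarith
  have hNs : s * (1 - s) * (2 - lam + lam * s) ≤ 1 / 2 := by nlinarith
  have hN1 : lam * (s * (1 - s)) ≤ 1 / 2 := by nlinarith
  rw [← div_div]
  unfold G
  split_ifs with h
  · apply div_le_div_of_nonneg_right _ hp.le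
    rcases le_total 0 (s * (2 * lam - 2 - lam * s)) with hc | hc
    · nlinarith [mul_nonneg hc (sub_nonneg.2 ht1)]
    · nlinarith [mul_nonneg (neg_nonneg.2 hc) (sub_nonneg.2 h)]
  · apply div_le_div_of_nonneg_right _ hp.le
    have h1 : 0 ≤ (1 - s) * (2 - lam + lam * s) := mul_nonneg (by linarith) hd0
    nlinarith [mul_nonneg h1 (sub_nonneg.2 (not_le.1 h).le)]
end

section
/- Let λ ∈ (0,2). Then t·G(1,s) ≤ G(t,s) ≤ (2/λ)·G(1,s) for all t, s ∈ [0,1]. -/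
open Set

theorem stmt_7 (lam : ℝ) (hlam : lam ∈ Ioo (0:ℝ) 2) :
    ∀ t ∈ Icc (0:ℝ) 1, ∀ s ∈ Icc (0:ℝ) 1,
      t * G lam 1 s ≤ G lam t s ∧ G lam t s ≤ (2 / lam) * G lam 1 s := by
  obtain ⟨h0, h2⟩ := hlam
  rintro t ⟨ht0, ht1⟩ s ⟨hs0, hs1⟩
  have hd : 0 < 2 - lam := by linarith
  have hG1 : G lam 1 s = lam * (s * (1 - s)) / (2 - lam) := by
    unfold G
    rw [if_pos hs1]
    congr 1
    ring
  have e1 : t * G lam 1 s = t * (lam * (s * (1 - s))) / (2 - lam) := by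
    rw [hG1]; ring
  have e2 : 2 / lam * G lam 1 s = 2 * (s * (1 - s)) / (2 - lam) := by
    rw [hG1]; field_simp
  have hs1' : 0 ≤ 1 - s := by linarith
  have ht1' : 0 ≤ 1 - t := by linarith
  rw [e1, e2]
  unfold G
  split_ifs with h
  · have hts : 0 ≤ t - s := by linarith
    constructor
    · apply div_le_div_of_nonneg_right _ hd.le
      have : 0 ≤ s * ((2 - lam) * (1 - t)) := by positivity
      linarith
    · apply div_le_div_of_nonneg_right _ hd.le
      have h3 : 0 ≤ s * ((2 - lam) * (t - s)) := by positivity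
      have h4 : 0 ≤ s * (lam * ((1 - t) * (1 - s))) := by positivity
      linarith
  · have hts : 0 ≤ s - t := by linarith
    constructor
    · apply div_le_div_of_nonneg_right _ hd.le
      have : 0 ≤ t * (1 - s) * (2 - lam) := by positivity
      linarith
    · apply div_le_div_of_nonneg_right _ hd.le
      have h3 : 0 ≤ (1 - s) * (2 * (s - t)) := by positivity
      have h4 : 0 ≤ (1 - s) * (t * (lam * (1 - s))) := by positivity
      linarith
end

section
/- Let m > 0 with sin m ≠ 0 (i.e., m is not an integer multiple of π), let λ ∈ ℝ with m·sin m − λ(1 − cos m) ≠ 0, and let σ : [0,1] → ℝ be continuous. Then the boundary value problem u''(t) + m²u(t) + σ(t) = 0 for 0 < t < 1, u(0) = 0, u(1) = λ∫₀¹ u(s) ds, has a unique solution u of class C² on [0,1], and it is given by u(t) = ∫₀¹ G_m(t,s) σ(s) ds. -/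
open Set

/-- Green's function for `u'' + m²u + σ = 0`, `u(0)=0`, `u(1)=λ∫₀¹u`. -/
noncomputable def Gm (m lam t s : ℝ) : ℝ :=
  if s ≤ t then
    (Real.sin (m * s) *
        (Real.sin (m - m * t) * (m * Real.sin m - lam * (1 - Real.cos m)) +
          lam * Real.sin (m * t)) +
      lam * Real.sin (m * t) * (Real.sin (m - m * s) - Real.sin m)) /
      (m * Real.sin m * (m * Real.sin m - lam * (1 - Real.cos m)))
  else
    (Real.sin (m * t) *
        (Real.sin (m - m * s) * (m * Real.sin m + lam * Real.cos m) +
          lam * (Real.sin (m * s) - Real.sin m))) /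
      (m * Real.sin m * (m * Real.sin m - lam * (1 - Real.cos m)))

theorem aux_unique (m : ℝ) (hm : 0 < m) (w w1 : ℝ → ℝ)
    (hw : ContinuousOn w (Icc 0 1)) (hw1 : ContinuousOn w1 (Icc 0 1))
    (h1 : ∀ t ∈ Ioo (0:ℝ) 1, HasDerivAt w (w1 t) t)
    (h2 : ∀ t ∈ Ioo (0:ℝ) 1, HasDerivAt w1 (-m ^ 2 * w t) t)
    (h0 : w 0 = 0) :
    ∃ c : ℝ, ∀ t ∈ Icc (0:ℝ) 1, w t = c * Real.sin (m * t) := by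
  have hs : ∀ t : ℝ, HasDerivAt (fun t => Real.sin (m * t)) (Real.cos (m * t) * m) t := by
    intro t
    simpa using ((hasDerivAt_id t).const_mul m).sin
  have hc : ∀ t : ℝ, HasDerivAt (fun t => Real.cos (m * t)) (-Real.sin (m * t) * m) t := by
    intro t
    simpa using ((hasDerivAt_id t).const_mul m).cos
  have hsc : ContinuousOn (fun t => Real.sin (m * t)) (Icc 0 1) := by fun_prop
  have hcc : ContinuousOn (fun t => Real.cos (m * t)) (Icc 0 1) := by fun_prop
  have key : ∀ f : ℝ → ℝ, ContinuousOn f (Icc 0 1) → (∀ t ∈ Ioo (0:ℝ) 1, HasDerivAt f 0 t) →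
      ∀ t ∈ Icc (0:ℝ) 1, f t = f 0 := by
    intro f hf hd
    intro t ht
    have hd0 : ∀ x ∈ interior (Icc (0:ℝ) 1), deriv f x = 0 := by
      intro x hx
      rw [interior_Icc] at hx
      exact (hd x hx).deriv
    have hdf : DifferentiableOn ℝ f (interior (Icc (0:ℝ) 1)) := by
      intro x hx
      rw [interior_Icc] at hx
      exact (hd x hx).differentiableAt.differentiableWithinAt
    have hmono := monotoneOn_of_deriv_nonneg (convex_Icc 0 1) hf hdf (fun x hx => (hd0 x hx).ge)
    have hanti := antitoneOn_of_deriv_nonpos (convex_Icc 0 1) hf hdf (fun x hx => (hd0 x hx).le)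
    have z : (0:ℝ) ∈ Icc (0:ℝ) 1 := by simp
    exact le_antisymm (hanti z ht ht.1) (hmono z ht ht.1)
  have hφ := key (fun t => w1 t * Real.sin (m * t) - m * (w t * Real.cos (m * t)))
    ((hw1.mul hsc).sub (continuousOn_const.mul (hw.mul hcc))) (by
      intro t ht
      have := ((h2 t ht).mul (hs t)).sub (((h1 t ht).mul (hc t)).const_mul m)
      refine this.congr_deriv ?_
      ring)
  have hψ := key (fun t => w1 t * Real.cos (m * t) + m * (w t * Real.sin (m * t)))
    ((hw1.mul hcc).add (continuousOn_const.mul (hw.mul hsc))) (by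
      intro t ht
      have := ((h2 t ht).mul (hc t)).add (((h1 t ht).mul (hs t)).const_mul m)
      refine this.congr_deriv ?_
      ring)
  refine ⟨w1 0 / m, fun t ht => ?_⟩
  have a := hφ t ht
  have b := hψ t ht
  simp [h0] at a b
  have e := Real.sin_sq_add_cos_sq (m * t)
  field_simp
  linear_combination Real.sin (m*t) * b - Real.cos (m*t) * a - m * w t * e

theorem stmt_8 (m lam : ℝ) (hm : 0 < m) (hsin : Real.sin m ≠ 0)
    (hD : m * Real.sin m - lam * (1 - Real.cos m) ≠ 0)
    (σ : ℝ → ℝ) (hσ : ContinuousOn σ (Icc 0 1)) :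
    ∃ u : ℝ → ℝ,
      (ContDiffOn ℝ 2 u (Icc 0 1) ∧
        (∀ t ∈ Ioo (0:ℝ) 1, deriv (deriv u) t + m ^ 2 * u t + σ t = 0) ∧
        u 0 = 0 ∧ u 1 = lam * ∫ s in (0:ℝ)..1, u s) ∧
      (∀ t ∈ Icc (0:ℝ) 1, u t = ∫ s in (0:ℝ)..1, Gm m lam t s * σ s) ∧
      (∀ v : ℝ → ℝ,
        (ContDiffOn ℝ 2 v (Icc 0 1) ∧
          (∀ t ∈ Ioo (0:ℝ) 1, deriv (deriv v) t + m ^ 2 * v t + σ t = 0) ∧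
          v 0 = 0 ∧ v 1 = lam * ∫ s in (0:ℝ)..1, v s) →
        EqOn v u (Icc 0 1)) := by
  have hm0 : m ≠ 0 := hm.ne'
  obtain ⟨τ, hτ, hτσ⟩ : ∃ τ : ℝ → ℝ, Continuous τ ∧ ∀ t ∈ Icc (0:ℝ) 1, τ t = σ t := by
    refine ⟨IccExtend zero_le_one ((Icc (0:ℝ) 1).domRestrict σ),
      (continuousOn_iff_continuous_domRestrict.1 hσ).Icc_extend', fun t ht => ?_⟩
    rw [IccExtend_of_mem _ _ ht]; rfl
  have hs : ∀ t : ℝ, HasDerivAt (fun t => Real.sin (m * t)) (Real.cos (m * t) * m) t := by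
    intro t
    simpa using ((hasDerivAt_id t).const_mul m).sin
  have hc : ∀ t : ℝ, HasDerivAt (fun t => Real.cos (m * t)) (-Real.sin (m * t) * m) t := by
    intro t
    simpa using ((hasDerivAt_id t).const_mul m).cos
  have hcτ : Continuous fun s => Real.cos (m * s) * τ s := by fun_prop
  have hsτ : Continuous fun s => Real.sin (m * s) * τ s := by fun_prop
  obtain ⟨A, hA⟩ : ∃ A : ℝ → ℝ, ∀ t, A t = ∫ s in (0:ℝ)..t, Real.cos (m * s) * τ s :=
    ⟨_, fun _ => rfl⟩
  obtain ⟨B, hB⟩ : ∃ B : ℝ → ℝ, ∀ t, B t = ∫ s in (0:ℝ)..t, Real.sin (m * s) * τ s :=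
    ⟨_, fun _ => rfl⟩
  obtain ⟨I, hI⟩ : ∃ I : ℝ, I = ∫ s in (0:ℝ)..1, τ s := ⟨_, rfl⟩
  have hA' : ∀ t, HasDerivAt A (Real.cos (m * t) * τ t) t := by
    intro t
    rw [show A = fun t => ∫ s in (0:ℝ)..t, Real.cos (m * s) * τ s from funext hA]
    exact (hcτ.integral_hasStrictDerivAt 0 t).hasDerivAt
  have hB' : ∀ t, HasDerivAt B (Real.sin (m * t) * τ t) t := by
    intro t
    rw [show B = fun t => ∫ s in (0:ℝ)..t, Real.sin (m * s) * τ s from funext hB]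
    exact (hsτ.integral_hasStrictDerivAt 0 t).hasDerivAt
  have hA0 : A 0 = 0 := by simp [hA]
  have hB0 : B 0 = 0 := by simp [hB]
  obtain ⟨K, hK⟩ : ∃ K : ℝ, K = (lam * (Real.cos m * A 1 + Real.sin m * B 1 - I) / m +
    (Real.sin m * A 1 - Real.cos m * B 1)) /
      (m * Real.sin m - lam * (1 - Real.cos m)) := ⟨_, rfl⟩
  obtain ⟨u, hu⟩ : ∃ u : ℝ → ℝ, u = fun t =>
    -(1 / m) * (Real.sin (m * t) * A t - Real.cos (m * t) * B t) + K * Real.sin (m * t) :=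
    ⟨_, rfl⟩
  obtain ⟨u1, hu1⟩ : ∃ u1 : ℝ → ℝ, u1 = fun t =>
    -(Real.cos (m * t) * A t + Real.sin (m * t) * B t) + K * (Real.cos (m * t) * m) :=
    ⟨_, rfl⟩
  have hdu : ∀ t, HasDerivAt u (u1 t) t := by
    intro t
    rw [hu, hu1]
    refine (((((hs t).mul (hA' t)).sub ((hc t).mul (hB' t))).const_mul (-(1/m))).add
      ((hs t).const_mul K)).congr_deriv ?_
    field_simp
    ring
  have hdu1 : ∀ t, HasDerivAt u1 (-m ^ 2 * u t - τ t) t := by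
    intro t
    rw [hu, hu1]
    refine (((((hc t).mul (hA' t)).add ((hs t).mul (hB' t))).neg).add
      (((hc t).mul_const m).const_mul K)).congr_deriv ?_
    have e := Real.sin_sq_add_cos_sq (m * t)
    field_simp
    linear_combination (-τ t) * e
  have hduf : deriv u = u1 := funext fun t => (hdu t).deriv
  have hdu1f : deriv u1 = fun t => -m ^ 2 * u t - τ t := funext fun t => (hdu1 t).deriv
  have huc : Continuous u := continuous_iff_continuousAt.2 fun t => (hdu t).continuousAt
  have hu1c : Continuous u1 := continuous_iff_continuousAt.2 fun t => (hdu1 t).continuousAt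
  have hC2 : ContDiff ℝ 2 u := by
    rw [show (2 : WithTop ℕ∞) = 1 + 1 by norm_num, contDiff_succ_iff_deriv]
    refine ⟨fun t => (hdu t).differentiableAt, by simp, ?_⟩
    rw [hduf, contDiff_one_iff_deriv]
    refine ⟨fun t => (hdu1 t).differentiableAt, ?_⟩
    rw [hdu1f]
    fun_prop
  have hintu : ∫ s in (0:ℝ)..1, u s = -(u1 1 - u1 0 + I) / m ^ 2 := by
    have h := intervalIntegral.integral_eq_sub_of_hasDerivAt (a := 0) (b := 1)
      (fun t _ => hdu1 t) (Continuous.intervalIntegrable (by fun_prop) _ _)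
    rw [intervalIntegral.integral_sub (Continuous.intervalIntegrable (by fun_prop) _ _)
      (hτ.intervalIntegrable _ _), intervalIntegral.integral_const_mul, ← hI] at h
    field_simp
    linarith
  have hbc0 : u 0 = 0 := by simp [hu, hB0]
  have hbc1 : u 1 = lam * ∫ s in (0:ℝ)..1, u s := by
    have hK' : K * (m * Real.sin m - lam * (1 - Real.cos m)) =
        (lam * (Real.cos m * A 1 + Real.sin m * B 1 - I) / m +
          (Real.sin m * A 1 - Real.cos m * B 1)) := by
      rw [hK, div_mul_cancel₀ _ hD]
    rw [hintu]
    simp [hu, hu1, hA0, hB0]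
    field_simp at hK' ⊢
    linear_combination hK'
  have hintsin : ∫ s in (0:ℝ)..1, Real.sin (m * s) = (1 - Real.cos m) / m := by
    have h := intervalIntegral.integral_eq_sub_of_hasDerivAt (a := 0) (b := 1)
      (fun t _ => hc t) (Continuous.intervalIntegrable (by fun_prop) _ _)
    rw [intervalIntegral.integral_mul_const, intervalIntegral.integral_neg] at h
    simp at h
    field_simp
    linarith
  refine ⟨u, ⟨hC2.contDiffOn, ?_, hbc0, hbc1⟩, ?_, ?_⟩
  · intro t ht
    rw [hduf, hdu1f]
    linear_combination -hτσ t (Ioo_subset_Icc_self ht)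
  · intro t ht
    obtain ⟨D, hDD⟩ : ∃ D, D = m * Real.sin m - lam * (1 - Real.cos m) := ⟨_, rfl⟩
    rw [← hDD] at hD hK
    have e1 : ∫ s in (0:ℝ)..1, Gm m lam t s * σ s =
        (∫ s in (0:ℝ)..1, Real.sin (m * t) / (m * Real.sin m * D) *
          ((Real.sin m * (m * Real.sin m + lam * Real.cos m)) * (Real.cos (m * s) * τ s) +
          (lam - Real.cos m * (m * Real.sin m + lam * Real.cos m)) * (Real.sin (m * s) * τ s)
            - lam * Real.sin m * τ s)) +
        ∫ s in (0:ℝ)..t, -(1 / m) * (Real.sin (m * t) * (Real.cos (m * s) * τ s) -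
          Real.cos (m * t) * (Real.sin (m * s) * τ s)) := by
      have hi1 : ∀ a b : ℝ, IntervalIntegrable (fun s => Real.sin (m * t) / (m * Real.sin m * D) *
          ((Real.sin m * (m * Real.sin m + lam * Real.cos m)) * (Real.cos (m * s) * τ s) +
          (lam - Real.cos m * (m * Real.sin m + lam * Real.cos m)) * (Real.sin (m * s) * τ s)
            - lam * Real.sin m * τ s)) MeasureTheory.volume a b :=
        fun a b => Continuous.intervalIntegrable (by fun_prop) _ _
      have hi2 : ∀ a b : ℝ, IntervalIntegrable (fun s =>
          -(1 / m) * (Real.sin (m * t) * (Real.cos (m * s) * τ s) -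
          Real.cos (m * t) * (Real.sin (m * s) * τ s))) MeasureTheory.volume a b :=
        fun a b => Continuous.intervalIntegrable (by fun_prop) _ _
      have c1 : EqOn (fun s => Real.sin (m * t) / (m * Real.sin m * D) *
          ((Real.sin m * (m * Real.sin m + lam * Real.cos m)) * (Real.cos (m * s) * τ s) +
          (lam - Real.cos m * (m * Real.sin m + lam * Real.cos m)) * (Real.sin (m * s) * τ s)
            - lam * Real.sin m * τ s) + -(1 / m) * (Real.sin (m * t) * (Real.cos (m * s) * τ s) -
          Real.cos (m * t) * (Real.sin (m * s) * τ s)))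
          (fun s => Gm m lam t s * σ s) (uIoc 0 t) := by
        intro s hs'
        rw [uIoc_of_le ht.1] at hs'
        have e := Real.sin_sq_add_cos_sq m
        simp only [Gm, if_pos hs'.2, ← hDD, Real.sin_sub]
        rw [hτσ s ⟨hs'.1.le, hs'.2.trans ht.2⟩]
        field_simp
        rw [hDD]
        ring
      have c2 : EqOn (fun s => Real.sin (m * t) / (m * Real.sin m * D) *
          ((Real.sin m * (m * Real.sin m + lam * Real.cos m)) * (Real.cos (m * s) * τ s) +
          (lam - Real.cos m * (m * Real.sin m + lam * Real.cos m)) * (Real.sin (m * s) * τ s)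
            - lam * Real.sin m * τ s))
          (fun s => Gm m lam t s * σ s) (uIoc t 1) := by
        intro s hs'
        rw [uIoc_of_le ht.2] at hs'
        simp only [Gm, if_neg (not_le.2 hs'.1), ← hDD, Real.sin_sub]
        rw [hτσ s ⟨ht.1.trans hs'.1.le, hs'.2⟩]
        field_simp
        ring
      rw [← intervalIntegral.integral_add_adjacent_intervals (b := t)
        (((hi1 0 t).add (hi2 0 t)).congr c1) ((hi1 t 1).congr c2),
        ← intervalIntegral.integral_add_adjacent_intervals (hi1 0 t) (hi1 t 1),
        ← intervalIntegral.integral_congr_ae (Filter.Eventually.of_forall c1),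
        ← intervalIntegral.integral_congr_ae (Filter.Eventually.of_forall c2),
        intervalIntegral.integral_add (hi1 0 t) (hi2 0 t)]
      ring
    have j1 : ∀ (c a b : ℝ), IntervalIntegrable (fun s => c * (Real.cos (m * s) * τ s))
      MeasureTheory.volume a b := fun c a b => Continuous.intervalIntegrable (by fun_prop) _ _
    have j2 : ∀ (c a b : ℝ), IntervalIntegrable (fun s => c * (Real.sin (m * s) * τ s))
      MeasureTheory.volume a b := fun c a b => Continuous.intervalIntegrable (by fun_prop) _ _
    have j3 : ∀ (c a b : ℝ), IntervalIntegrable (fun s => c * τ s)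
      MeasureTheory.volume a b := fun c a b => Continuous.intervalIntegrable (by fun_prop) _ _
    rw [e1, intervalIntegral.integral_const_mul, intervalIntegral.integral_const_mul,
      intervalIntegral.integral_sub ((j1 _ _ _).add (j2 _ _ _)) (j3 _ _ _),
      intervalIntegral.integral_add (j1 _ _ _) (j2 _ _ _),
      intervalIntegral.integral_sub (j1 _ _ _) (j2 _ _ _)]
    simp only [intervalIntegral.integral_const_mul, ← hA, ← hB, ← hI]
    have e := Real.sin_sq_add_cos_sq m
    rw [hu, hK]
    field_simp
    linear_combination (Real.sin (m * t) * lam * B 1) * e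
  · rintro v ⟨hv, hvd, hv0, hv1⟩ t ht
    have hvc : ContinuousOn v (Icc 0 1) := hv.continuousOn
    have hv' : ContDiffOn ℝ 1 (derivWithin v (Icc 0 1)) (Icc 0 1) :=
      hv.derivWithin (uniqueDiffOn_Icc zero_lt_one) (by norm_num)
    have hev : ∀ t ∈ Ioo (0:ℝ) 1, derivWithin v (Icc 0 1) =ᶠ[nhds t] deriv v := by
      intro t ht
      filter_upwards [isOpen_Ioo.mem_nhds ht] with x hx
      exact derivWithin_of_mem_nhds (Icc_mem_nhds hx.1 hx.2)
    obtain ⟨c, hcw⟩ := aux_unique m hm (fun t => v t - u t)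
      (fun t => derivWithin v (Icc 0 1) t - u1 t)
      (hvc.sub huc.continuousOn) (hv'.continuousOn.sub hu1c.continuousOn)
      (by
        intro t ht
        have hn := Icc_mem_nhds ht.1 ht.2
        have := ((hv.contDiffAt hn).differentiableAt (by norm_num)).hasDerivAt
        rw [← (hev t ht).eq_of_nhds] at this
        exact this.sub (hdu t))
      (by
        intro t ht
        have hn := Icc_mem_nhds ht.1 ht.2
        have := ((hv'.contDiffAt hn).differentiableAt (by norm_num)).hasDerivAt
        rw [(hev t ht).deriv_eq] at this
        refine (this.sub (hdu1 t)).congr_deriv ?_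
        have := hvd t ht
        rw [hτσ t (Ioo_subset_Icc_self ht)]
        linear_combination this)
      (by simp [hv0, hbc0])
    have hint : ∫ s in (0:ℝ)..1, (v s - u s) = c * ((1 - Real.cos m) / m) := by
      rw [← hintsin, ← intervalIntegral.integral_const_mul]
      apply intervalIntegral.integral_congr
      intro s hs'
      rw [uIcc_of_le zero_le_one] at hs'
      exact hcw s hs'
    rw [intervalIntegral.integral_sub
      (ContinuousOn.intervalIntegrable (by rwa [uIcc_of_le zero_le_one]))
      (huc.intervalIntegrable _ _)] at hint
    have h1 := hcw 1 (by simp)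
    simp only [mul_one] at h1
    have hc0 : c * (m * Real.sin m - lam * (1 - Real.cos m)) = 0 := by
      have h3 : c * Real.sin m = lam * (c * ((1 - Real.cos m) / m)) := by
        rw [← hint, ← h1, hv1, hbc1]; ring
      field_simp at h3
      linear_combination h3
    have hcz : c = 0 := (mul_eq_zero.1 hc0).resolve_right hD
    have := hcw t ht
    simp only [hcz, zero_mul] at this
    linarith
end

section
/- Let m ∈ (0,2π) with m ≠ π and let λ ∈ ℝ with m·sin m − λ(1 − cos m) ≠ 0. Then G_m(1,s) = 0 for all s ∈ (0,1) if and only if λ = 0. -/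
open Set

theorem stmt_10 (m lam : ℝ) (hm : m ∈ Ioo 0 (2 * Real.pi)) (hmpi : m ≠ Real.pi)
    (hD : m * Real.sin m - lam * (1 - Real.cos m) ≠ 0) :
    (∀ s ∈ Ioo (0:ℝ) 1, Gm m lam 1 s = 0) ↔ lam = 0 := by
  obtain ⟨h0, h2⟩ := hm
  constructor
  · intro h
    have h1 := h (1/2) ⟨by norm_num, by norm_num⟩
    have hs2 : 0 < Real.sin (m/2) := Real.sin_pos_of_pos_of_lt_pi (by linarith) (by linarith)
    have e1 : Real.sin m = 2 * Real.sin (m/2) * Real.cos (m/2) := by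
      rw [← Real.sin_two_mul]; congr 1; ring
    have hc : Real.cos (m/2) ≠ 0 := by
      intro hc
      apply hmpi
      have h3 : Real.cos (m/2) = Real.cos (Real.pi/2) := by rw [hc, Real.cos_pi_div_two]
      have := Real.injOn_cos ⟨by linarith, by linarith⟩
        ⟨by linarith [Real.pi_pos], by linarith [Real.pi_pos]⟩ h3
      linarith
    have hsm : Real.sin m ≠ 0 := by
      rw [e1]; exact mul_ne_zero (mul_ne_zero two_ne_zero hs2.ne') hc
    have hc1 : 1 - Real.cos (m/2) ≠ 0 := by
      intro hc1
      have := Real.sin_sq_add_cos_sq (m/2)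
      have hh : Real.cos (m/2) = 1 := by linarith
      rw [hh] at this
      nlinarith
    unfold Gm at h1
    rw [if_pos (by norm_num), div_eq_zero_iff] at h1
    rcases h1 with h1 | h1
    · have a1 : m * (1/2) = m/2 := by ring
      have a2 : m - m/2 = m/2 := by ring
      rw [a1, a2, mul_one, sub_self, Real.sin_zero] at h1
      have h4 : lam * (Real.sin m * (2 * Real.sin (m/2) * (1 - Real.cos (m/2)))) = 0 := by
        linear_combination h1 + lam * Real.sin m * e1
      rcases mul_eq_zero.mp h4 with h5 | h5
      · exact h5
      · exact absurd h5 (mul_ne_zero hsm (mul_ne_zero (mul_ne_zero two_ne_zero hs2.ne') hc1))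
    · exact absurd h1 (mul_ne_zero (mul_ne_zero h0.ne' hsm) hD)
  · rintro rfl s ⟨hs0, hs1⟩
    unfold Gm
    rw [if_pos hs1.le]
    simp
end

section
/- Let m ∈ (0,2π) with m ≠ π and let λ > 0 with m·sin m − λ(1 − cos m) ≠ 0. Then (m·sin m − λ(1 − cos m))·G_m(1,s) > 0 for all s ∈ (0,1); indeed (m·sin m − λ(1 − cos m))·G_m(1,s) = (λ/m)·(sin(ms) + sin(m−ms) − sin m), and sin(ms) + sin(m−ms) − sin m > 0 for all s ∈ (0,1). -/
open Set

theorem stmt_11 (m lam : ℝ) (hm : m ∈ Ioo 0 (2 * Real.pi)) (hmpi : m ≠ Real.pi)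
    (hlam : 0 < lam) (hD : m * Real.sin m - lam * (1 - Real.cos m) ≠ 0) :
    ∀ s ∈ Ioo (0:ℝ) 1,
      0 < (m * Real.sin m - lam * (1 - Real.cos m)) * Gm m lam 1 s ∧
      (m * Real.sin m - lam * (1 - Real.cos m)) * Gm m lam 1 s =
        (lam / m) * (Real.sin (m * s) + Real.sin (m - m * s) - Real.sin m) ∧
      0 < Real.sin (m * s) + Real.sin (m - m * s) - Real.sin m := by
  intro s hs
  obtain ⟨h0, h2⟩ := hm
  obtain ⟨hs0, hs1⟩ := hs
  have hsin : Real.sin m ≠ 0 := by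
    rcases lt_or_gt_of_ne hmpi with h | h
    · exact (Real.sin_pos_of_pos_of_lt_pi h0 h).ne'
    · have h3 : 0 < Real.sin (m - Real.pi) :=
        Real.sin_pos_of_pos_of_lt_pi (by linarith) (by linarith)
      rw [Real.sin_sub_pi] at h3
      have h4 : Real.sin m < 0 := by linarith
      exact h4.ne
  have hpos : 0 < Real.sin (m * s) + Real.sin (m - m * s) - Real.sin m := by
    have hms : 0 < m * s := mul_pos h0 hs0
    have hms1 : m * s < m := by nlinarith
    obtain ⟨a, ha⟩ : ∃ a, a = m * s / 2 := ⟨_, rfl⟩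
    obtain ⟨b, hb⟩ : ∃ b, b = (m - m * s) / 2 := ⟨_, rfl⟩
    have e1 : m * s = 2 * a := by linarith
    have e2 : m - m * s = 2 * b := by linarith
    have e3 : m = 2 * (a + b) := by linarith
    have hA : 0 < Real.sin a := Real.sin_pos_of_pos_of_lt_pi (by linarith) (by linarith)
    have hB : 0 < Real.sin b := Real.sin_pos_of_pos_of_lt_pi (by linarith) (by linarith)
    have hC : 0 < Real.sin (a + b) :=
      Real.sin_pos_of_pos_of_lt_pi (by linarith) (by linarith)
    have key : Real.sin (2 * a) + Real.sin (2 * b) - Real.sin (2 * (a + b))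
        = 4 * (Real.sin a * Real.sin b * Real.sin (a + b)) := by
      rw [Real.sin_two_mul, Real.sin_two_mul, Real.sin_two_mul, Real.sin_add, Real.cos_add]
      have ca := Real.sin_sq_add_cos_sq a
      have cb := Real.sin_sq_add_cos_sq b
      have ca' : Real.cos a ^ 2 = 1 - Real.sin a ^ 2 := by linarith
      have cb' : Real.cos b ^ 2 = 1 - Real.sin b ^ 2 := by linarith
      ring_nf
      rw [ca', cb']
      ring
    have e4 : Real.sin m = Real.sin (2 * (a + b)) := congrArg Real.sin e3
    rw [e2, e1, e4, key]
    positivity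
  have heq : (m * Real.sin m - lam * (1 - Real.cos m)) * Gm m lam 1 s =
        (lam / m) * (Real.sin (m * s) + Real.sin (m - m * s) - Real.sin m) := by
    unfold Gm
    rw [if_pos hs1.le, mul_one, sub_self, Real.sin_zero]
    generalize m * Real.sin m - lam * (1 - Real.cos m) = D at hD
    have hm0 := h0.ne'
    field_simp
    ring
  refine ⟨?_, heq, hpos⟩
  rw [heq]
  positivity
end

section
/- Let m ∈ (0,π) and let λ ∈ ℝ with m·sin m − λ(1 − cos m) ≠ 0. Then G_m(t,s) > 0 for all t, s ∈ (0,1) if and only if 0 ≤ λ < m·sin m/(1 − cos m). -/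
open Set

lemma aux_K (m s : ℝ) (hm0 : 0 < m) (hmp : m < Real.pi) (h0 : 0 < s) (h1 : s < 1) :
    0 < Real.sin (m * s) + Real.sin (m - m * s) - Real.sin m := by
  obtain ⟨a, ha⟩ : ∃ a, a = m * s / 2 := ⟨_, rfl⟩
  obtain ⟨b, hb⟩ : ∃ b, b = (m - m * s) / 2 := ⟨_, rfl⟩
  have e1 : m * s = 2 * a := by rw [ha]; ring
  have e2 : m - m * s = 2 * b := by rw [hb]; ring
  have e3 : m = 2 * (a + b) := by linarith
  have ha0 : 0 < a := by rw [ha]; positivity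
  have hb0 : 0 < b := by rw [hb]; nlinarith
  have key : Real.sin (m * s) + Real.sin (m - m * s) - Real.sin m
      = 4 * Real.sin (a + b) * Real.sin a * Real.sin b := by
    rw [e2, e1, e3, Real.sin_two_mul, Real.sin_two_mul, Real.sin_two_mul, Real.sin_add,
      Real.cos_add]
    have h1 := Real.sin_sq_add_cos_sq a
    have h2 := Real.sin_sq_add_cos_sq b
    have h1' : Real.cos a ^ 2 = 1 - Real.sin a ^ 2 := by linarith
    have h2' : Real.cos b ^ 2 = 1 - Real.sin b ^ 2 := by linarith
    ring_nf
    simp only [h1', h2']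
    ring
  rw [key]
  have p1 := Real.sin_pos_of_pos_of_lt_pi ha0 (by linarith)
  have p2 := Real.sin_pos_of_pos_of_lt_pi hb0 (by linarith)
  have p3 := Real.sin_pos_of_pos_of_lt_pi (add_pos ha0 hb0) (by linarith)
  positivity

theorem stmt_12 (m lam : ℝ) (hm : m ∈ Ioo 0 Real.pi)
    (hD : m * Real.sin m - lam * (1 - Real.cos m) ≠ 0) :
    (∀ t ∈ Ioo (0:ℝ) 1, ∀ s ∈ Ioo (0:ℝ) 1, Gm m lam t s > 0) ↔
      (0 ≤ lam ∧ lam < m * Real.sin m / (1 - Real.cos m)) := by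
  obtain ⟨hm0, hmp⟩ := hm
  have hs : 0 < Real.sin m := Real.sin_pos_of_pos_of_lt_pi hm0 hmp
  have hc : 0 < 1 - Real.cos m := by
    nlinarith [Real.sin_sq_add_cos_sq m, Real.cos_le_one m, mul_pos hs hs]
  have hms : 0 < m * Real.sin m := mul_pos hm0 hs
  rw [lt_div_iff₀ hc]
  constructor
  · intro h
    have hK := aux_K m (1/2) hm0 hmp (by norm_num) (by norm_num)
    let f : ℝ → ℝ := fun t => (Real.sin (m * (1/2)) *
        (Real.sin (m - m * t) * (m * Real.sin m - lam * (1 - Real.cos m)) +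
          lam * Real.sin (m * t)) +
      lam * Real.sin (m * t) * (Real.sin (m - m * (1/2)) - Real.sin m)) /
      (m * Real.sin m * (m * Real.sin m - lam * (1 - Real.cos m)))
    have hf : Continuous f := by
      apply Continuous.div_const
      fun_prop
    have h1 : 0 ≤ f 1 := by
      have ht : Filter.Tendsto f (nhdsWithin 1 (Iio 1)) (nhds (f 1)) :=
        (hf.tendsto 1).mono_left nhdsWithin_le_nhds
      refine ge_of_tendsto ht ?_
      filter_upwards [Ioo_mem_nhdsLT (show (1/2:ℝ) < 1 by norm_num)] with t ht
      have := h t ⟨by linarith [ht.1], ht.2⟩ (1/2) ⟨by norm_num, by norm_num⟩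
      rw [Gm, if_pos ht.1.le] at this
      exact this.le
    have e : f 1 = lam * (Real.sin m * (Real.sin (m * (1/2)) + Real.sin (m - m * (1/2))
        - Real.sin m)) / (m * Real.sin m * (m * Real.sin m - lam * (1 - Real.cos m))) := by
      simp only [f, mul_one, sub_self, Real.sin_zero]
      congr 1
      ring
    rw [e] at h1
    have hSK := mul_pos hs hK
    rcases lt_or_gt_of_ne hD with hneg | hpos
    · exfalso
      have hl : 0 < lam := by
        by_contra hl
        nlinarith
      exact absurd h1 (not_le.mpr (div_neg_of_pos_of_neg (mul_pos hl hSK)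
        (mul_neg_of_pos_of_neg hms hneg)))
    · refine ⟨?_, by linarith⟩
      by_contra hl
      push Not at hl
      exact absurd h1 (not_le.mpr (div_neg_of_neg_of_pos (mul_neg_of_neg_of_pos hl hSK)
        (mul_pos hms hpos)))
  · rintro ⟨hl, hlt⟩ t ⟨ht0, ht1⟩ s ⟨hs0, hs1⟩
    have hpos : 0 < m * Real.sin m - lam * (1 - Real.cos m) := by linarith
    have hK := aux_K m s hm0 hmp hs0 hs1
    have sp : ∀ x, 0 < x → x < 1 → 0 < Real.sin (m * x) ∧ 0 < Real.sin (m - m * x) := by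
      intro x h0 h1
      have hx : 0 < m * x := by positivity
      have hx' : m * x < m := by nlinarith
      exact ⟨Real.sin_pos_of_pos_of_lt_pi hx (by linarith),
        Real.sin_pos_of_pos_of_lt_pi (by linarith) (by linarith)⟩
    obtain ⟨a1, a2⟩ := sp t ht0 ht1
    obtain ⟨b1, b2⟩ := sp s hs0 hs1
    have q1 := mul_nonneg (mul_nonneg hl a1.le) hK.le
    rw [Gm]
    split_ifs
    · refine div_pos ?_ (mul_pos hms hpos)
      have q2 := mul_pos (mul_pos b1 a2) hpos
      linarith
    · refine div_pos ?_ (mul_pos hms hpos)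
      have q2 := mul_pos (mul_pos a1 b2) hpos
      linarith
end

section
/- Let m ∈ (0,π) and let λ ∈ ℝ with λ ∉ [0, m·sin m/(1 − cos m)) and m·sin m − λ(1 − cos m) ≠ 0. Then G_m changes sign on (0,1) × (0,1); that is, there exist points (t₁,s₁), (t₂,s₂) ∈ (0,1) × (0,1) with G_m(t₁,s₁) > 0 and G_m(t₂,s₂) < 0. -/
open Set

open Filter Topology in
theorem exists_pos_right (f : ℝ → ℝ) (hf : Continuous f) (h0 : 0 < f 0) :
    ∃ x ∈ Ioo (0:ℝ) (1/2), 0 < f x := by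
  have h1 : ∀ᶠ x in 𝓝[>] (0:ℝ), 0 < f x :=
    nhdsWithin_le_nhds (hf.continuousAt.eventually (lt_mem_nhds h0))
  have h2 : ∀ᶠ x in 𝓝[>] (0:ℝ), x ∈ Ioo (0:ℝ) (1/2) := Ioo_mem_nhdsGT (by norm_num)
  obtain ⟨x, hx1, hx2⟩ := (h1.and h2).exists
  exact ⟨x, hx2, hx1⟩

theorem Gm_eq (m lam t s : ℝ) (hst : s ≤ t)
    (hD : m * Real.sin m - lam * (1 - Real.cos m) ≠ 0) :
    Gm m lam t s = (Real.sin (m * s) * Real.sin (m - m * t) +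
      lam / (m * Real.sin m - lam * (1 - Real.cos m)) * Real.sin (m * t) *
        (Real.sin (m * s) + Real.sin (m - m * s) - Real.sin m)) / (m * Real.sin m) := by
  rw [Gm, if_pos hst]
  generalize m * Real.sin m - lam * (1 - Real.cos m) = D at *
  rw [mul_comm (m * Real.sin m) D, ← div_div]
  congr 1
  field_simp
  ring

theorem stmt_13 (m lam : ℝ) (hm : m ∈ Ioo 0 Real.pi)
    (hlam : lam ∉ Ico (0:ℝ) (m * Real.sin m / (1 - Real.cos m)))
    (hD : m * Real.sin m - lam * (1 - Real.cos m) ≠ 0) :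
    (∃ t₁ ∈ Ioo (0:ℝ) 1, ∃ s₁ ∈ Ioo (0:ℝ) 1, Gm m lam t₁ s₁ > 0) ∧
    (∃ t₂ ∈ Ioo (0:ℝ) 1, ∃ s₂ ∈ Ioo (0:ℝ) 1, Gm m lam t₂ s₂ < 0) := by
  obtain ⟨hm0, hmpi⟩ := hm
  have hsin : 0 < Real.sin m := Real.sin_pos_of_pos_of_lt_pi hm0 hmpi
  have hms : 0 < m * Real.sin m := mul_pos hm0 hsin
  have hcos : 0 < 1 - Real.cos m := by
    have h := Real.cos_lt_cos_of_nonneg_of_le_pi le_rfl hmpi.le hm0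
    rw [Real.cos_zero] at h
    linarith
  have hc : lam / (m * Real.sin m - lam * (1 - Real.cos m)) < 0 := by
    by_cases h0 : lam < 0
    · apply div_neg_of_neg_of_pos h0
      nlinarith
    · have h0' : 0 ≤ lam := not_lt.mp h0
      have h1 : m * Real.sin m / (1 - Real.cos m) ≤ lam := by
        by_contra h
        exact hlam ⟨h0', not_le.mp h⟩
      rw [div_le_iff₀ hcos] at h1
      have h2 : m * Real.sin m - lam * (1 - Real.cos m) < 0 :=
        lt_of_le_of_ne (by linarith) hD
      have h3 : 0 < lam := by nlinarith
      exact div_neg_of_pos_of_neg h3 h2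
  have hG := fun t s hst => Gm_eq m lam t s hst hD
  generalize lam / (m * Real.sin m - lam * (1 - Real.cos m)) = c at hc hG
  constructor
  · obtain ⟨x, ⟨hx0, hx1⟩, hx⟩ := exists_pos_right
      (fun s => Real.sin (m - m * s) +
        c * (Real.sin (m * s) + Real.sin (m - m * s) - Real.sin m)) (by fun_prop)
      (by simpa using hsin)
    refine ⟨x, ⟨hx0, by linarith⟩, x, ⟨hx0, by linarith⟩, ?_⟩
    rw [hG x x le_rfl]
    apply div_pos _ hms
    have hs : 0 < Real.sin (m * x) :=
      Real.sin_pos_of_pos_of_lt_pi (mul_pos hm0 hx0) (by nlinarith)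
    have := mul_pos hs hx
    linarith
  · have hK : 0 < Real.sin (m * (1/2)) + Real.sin (m - m * (1/2)) - Real.sin m := by
      have e1 : m - m * (1/2) = m * (1/2) := by ring
      have e2 : Real.sin m = 2 * Real.sin (m * (1/2)) * Real.cos (m * (1/2)) := by
        rw [← Real.sin_two_mul]; congr 1; ring
      have h1 : 0 < Real.sin (m * (1/2)) :=
        Real.sin_pos_of_pos_of_lt_pi (by linarith) (by linarith)
      have h2 : Real.cos (m * (1/2)) < 1 := by
        have h := Real.cos_lt_cos_of_nonneg_of_le_pi le_rfl
          (by linarith : m * (1/2) ≤ Real.pi) (by linarith)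
        rwa [Real.cos_zero] at h
      rw [e1, e2]
      nlinarith
    obtain ⟨x, ⟨hx0, hx1⟩, hx⟩ := exists_pos_right
      (fun y => -(Real.sin (m * (1/2)) * Real.sin (m - m * (1 - y)) +
        c * Real.sin (m * (1 - y)) *
          (Real.sin (m * (1/2)) + Real.sin (m - m * (1/2)) - Real.sin m))) (by fun_prop)
      (by
        have h := mul_pos (mul_pos (neg_pos.mpr hc) hsin) hK
        simp only [sub_zero, mul_one, sub_self, Real.sin_zero, mul_zero, zero_add]
        linarith)
    refine ⟨1 - x, ⟨by linarith, by linarith⟩, 1/2, ⟨by norm_num, by norm_num⟩, ?_⟩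
    rw [hG (1 - x) (1/2) (by linarith)]
    exact div_neg_of_neg_of_pos (neg_pos.mp hx) hms
end

section
/- Let m ∈ (0,π) and 0 < λ < m·sin m/(1 − cos m). Then there exist a continuous function h₁ : [0,1] → ℝ with h₁(t) > 0 for all t ∈ (0,1], and a constant C₁ > 0, such that h₁(t)·G_m(1,s) ≤ G_m(t,s) ≤ C₁·G_m(1,s) for all t, s ∈ [0,1]. -/
open Set

lemma aux_sin (x y : ℝ) (hx : 0 ≤ x) (hxy : x ≤ y) (hy : y < Real.pi) :
    Real.sin x ≤ 2 * Real.sin (y / 2) := by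
  have h1 : Real.sin x = 2 * Real.sin (x / 2) * Real.cos (x / 2) := by
    rw [← Real.sin_two_mul]; congr 1; ring
  have h2 : Real.sin (x / 2) ≤ Real.sin (y / 2) :=
    Real.sin_le_sin_of_le_of_le_pi_div_two (by linarith) (by linarith) (by linarith)
  have h3 : 0 ≤ Real.sin (x / 2) :=
    Real.sin_nonneg_of_nonneg_of_le_pi (by linarith) (by linarith)
  have h4 := Real.cos_le_one (x / 2)
  nlinarith

lemma aux_phi (a b : ℝ) : Real.sin a + Real.sin b - Real.sin (a + b) =
    4 * Real.sin (a / 2) * Real.sin (b / 2) * Real.sin ((a + b) / 2) := by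
  obtain ⟨x, rfl⟩ : ∃ x, a = 2 * x := ⟨a / 2, by ring⟩
  obtain ⟨y, rfl⟩ : ∃ y, b = 2 * y := ⟨b / 2, by ring⟩
  have e1 : 2 * x / 2 = x := by ring
  have e2 : 2 * y / 2 = y := by ring
  have e3 : (2 * x + 2 * y) / 2 = x + y := by ring
  have e4 : 2 * x + 2 * y = 2 * (x + y) := by ring
  rw [e1, e2, e3, e4, Real.sin_two_mul, Real.sin_two_mul, Real.sin_two_mul, Real.sin_add,
    Real.cos_add]
  have hx := Real.sin_sq_add_cos_sq x
  have hy := Real.sin_sq_add_cos_sq y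
  linear_combination (2 * Real.sin x * Real.cos x) * (-hy) + (2 * Real.sin y * Real.cos y) * (-hx)

theorem stmt_14 (m lam : ℝ) (hm : m ∈ Ioo 0 Real.pi)
    (hlam : 0 < lam) (hlam' : lam < m * Real.sin m / (1 - Real.cos m)) :
    ∃ h₁ : ℝ → ℝ, ∃ C₁ : ℝ,
      ContinuousOn h₁ (Icc 0 1) ∧ (∀ t ∈ Ioc (0:ℝ) 1, 0 < h₁ t) ∧ 0 < C₁ ∧
      ∀ t ∈ Icc (0:ℝ) 1, ∀ s ∈ Icc (0:ℝ) 1,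
        h₁ t * Gm m lam 1 s ≤ Gm m lam t s ∧ Gm m lam t s ≤ C₁ * Gm m lam 1 s := by
  obtain ⟨hm0, hmpi⟩ := hm
  have hS : 0 < Real.sin m := Real.sin_pos_of_pos_of_lt_pi hm0 hmpi
  have hh : 0 < Real.sin (m / 2) :=
    Real.sin_pos_of_pos_of_lt_pi (by linarith) (by linarith)
  have hc : 0 < 1 - Real.cos m := by
    nlinarith [Real.sin_sq_add_cos_sq m, Real.cos_le_one m]
  have hD : 0 < m * Real.sin m - lam * (1 - Real.cos m) := by
    rw [lt_div_iff₀ hc] at hlam'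
    linarith
  set S := Real.sin m with hSdef
  set D := m * S - lam * (1 - Real.cos m) with hDdef
  have hG1 : ∀ s ∈ Icc (0:ℝ) 1, Gm m lam 1 s =
      lam * S * (Real.sin (m * s) + Real.sin (m - m * s) - S) / (m * S * D) := by
    intro s hs
    rw [Gm, if_pos hs.2]
    congr 1
    simp only [mul_one, sub_self, Real.sin_zero]
    ring
  have hq : 0 < m * S * D := by positivity
  have key : ∀ t ∈ Icc (0:ℝ) 1, ∀ s ∈ Icc (0:ℝ) 1, ∃ k, 0 ≤ k ∧
      k ≤ 4 * Real.sin (m * s / 2) * Real.sin ((m - m * s) / 2) ∧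
      Gm m lam t s = (k * D + lam * Real.sin (m * t) *
        (Real.sin (m * s) + Real.sin (m - m * s) - S)) / (m * S * D) := by
    intro t ht s hs
    obtain ⟨ht0, ht1⟩ := ht
    obtain ⟨hs0, hs1⟩ := hs
    have a1 : 0 ≤ m * s := by positivity
    have a2 : 0 ≤ m * t := by positivity
    have a3 : m * s ≤ m := by nlinarith
    have a4 : m * t ≤ m := by nlinarith
    have p1 : 0 ≤ Real.sin (m * s) := Real.sin_nonneg_of_nonneg_of_le_pi a1 (by linarith)
    have p2 : 0 ≤ Real.sin (m * t) := Real.sin_nonneg_of_nonneg_of_le_pi a2 (by linarith)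
    have p3 : 0 ≤ Real.sin (m - m * s) :=
      Real.sin_nonneg_of_nonneg_of_le_pi (by linarith) (by linarith)
    have p4 : 0 ≤ Real.sin (m - m * t) :=
      Real.sin_nonneg_of_nonneg_of_le_pi (by linarith) (by linarith)
    by_cases hst : s ≤ t
    · have a5 : m * s ≤ m * t := by nlinarith
      have b1 := aux_sin (m * s) (m * s) a1 le_rfl (by linarith)
      have b2 := aux_sin (m - m * t) (m - m * s) (by linarith) (by linarith) (by linarith)
      refine ⟨Real.sin (m * s) * Real.sin (m - m * t), by positivity, ?_, ?_⟩
      · have := mul_le_mul b1 b2 p4 (p1.trans b1)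
        linarith
      · rw [Gm, if_pos hst]
        congr 1
        ring
    · have a5 : m * t ≤ m * s := by nlinarith
      have b1 := aux_sin (m * t) (m * s) a2 a5 (by linarith)
      have b2 := aux_sin (m - m * s) (m - m * s) (by linarith) le_rfl (by linarith)
      refine ⟨Real.sin (m * t) * Real.sin (m - m * s), by positivity, ?_, ?_⟩
      · have := mul_le_mul b1 b2 p3 (p2.trans b1)
        linarith
      · rw [Gm, if_neg hst]
        congr 1
        rw [hDdef]
        ring
  refine ⟨fun t => Real.sin (m * t) / S, (D / Real.sin (m / 2) + lam) / (lam * S),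
    by fun_prop, ?_, by positivity, ?_⟩
  · intro t ht
    have : 0 < m * t := mul_pos hm0 ht.1
    have h2 : m * t ≤ m := by nlinarith [ht.2]
    exact div_pos (Real.sin_pos_of_pos_of_lt_pi this (by linarith)) hS
  · intro t ht s hs
    obtain ⟨k, hk0, hk, hG⟩ := key t ht s hs
    have hphi := aux_phi (m * s) (m - m * s)
    rw [show m * s + (m - m * s) = m by ring, ← hSdef] at hphi
    have hkphi : k * Real.sin (m / 2) ≤ Real.sin (m * s) + Real.sin (m - m * s) - S := by
      rw [hphi]
      exact mul_le_mul_of_nonneg_right hk hh.le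
    have hphi0 : 0 ≤ Real.sin (m * s) + Real.sin (m - m * s) - S :=
      (mul_nonneg hk0 hh.le).trans hkphi
    rw [hG, hG1 s hs]
    generalize Real.sin (m * s) + Real.sin (m - m * s) - S = φ at *
    constructor
    · rw [← mul_div_assoc]
      apply div_le_div_of_nonneg_right _ hq.le
      have : Real.sin (m * t) / S * (lam * S * φ) = lam * Real.sin (m * t) * φ := by
        field_simp
      dsimp only
      rw [this]
      nlinarith [mul_nonneg hk0 hD.le]
    · rw [← mul_div_assoc]
      apply div_le_div_of_nonneg_right _ hq.le
      have e : (D / Real.sin (m / 2) + lam) / (lam * S) * (lam * S * φ) =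
          φ / Real.sin (m / 2) * D + lam * 1 * φ := by
        field_simp
      rw [e]
      have h1 : k ≤ φ / Real.sin (m / 2) := by rwa [le_div_iff₀ hh]
      have h2 := Real.sin_le_one (m * t)
      gcongr
end

section
/- Let m > 0 and 0 < λ < m·sinh m/(cosh m − 1). Then there exist a continuous function h₂ : [0,1] → ℝ with h₂(t) > 0 for all t ∈ (0,1], and a constant C₂ > 0, such that h₂(t)·H_m(1,s) ≤ H_m(t,s) ≤ C₂·H_m(1,s) for all t, s ∈ [0,1]. -/
open Set

/-- Green's function for `u'' − m²u + σ = 0`, `u(0)=0`, `u(1)=λ∫₀¹u`. -/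
noncomputable def Hm (m lam t s : ℝ) : ℝ :=
  if s ≤ t then
    (Real.sinh (m * s) *
        (Real.sinh (m - m * t) * (m * Real.sinh m + lam * (1 - Real.cosh m)) -
          lam * Real.sinh (m * t)) -
      lam * Real.sinh (m * t) * (Real.sinh (m - m * s) - Real.sinh m)) /
      (m * Real.sinh m * (m * Real.sinh m + lam * (1 - Real.cosh m)))
  else
    (Real.sinh (m * t) *
        (Real.sinh (m - m * s) * (m * Real.sinh m - lam * Real.cosh m) -
          lam * (Real.sinh (m * s) - Real.sinh m))) /
      (m * Real.sinh m * (m * Real.sinh m + lam * (1 - Real.cosh m)))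

lemma key_P (a b : ℝ) : Real.sinh (2*a+2*b) - Real.sinh (2*a) - Real.sinh (2*b)
    = 4 * Real.sinh a * Real.sinh b * Real.sinh (a+b) := by
  have h : 2*a+2*b = 2*(a+b) := by ring
  have ha := Real.cosh_sq a
  have hb := Real.cosh_sq b
  rw [h, Real.sinh_two_mul, Real.sinh_two_mul, Real.sinh_two_mul, Real.sinh_add, Real.cosh_add]
  linear_combination (2 * Real.sinh b * Real.cosh b) * ha + (2 * Real.sinh a * Real.cosh a) * hb

lemma key_le (a b : ℝ) (ha : 0 ≤ a) (hb : 0 ≤ b) (hab : 0 < a + b) :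
    Real.sinh (2*a) * Real.sinh (2*b) ≤ Real.cosh (a+b) / Real.sinh (a+b) *
      (Real.sinh (2*a+2*b) - Real.sinh (2*a) - Real.sinh (2*b)) := by
  have hs : 0 < Real.sinh (a+b) := Real.sinh_pos_iff.2 hab
  have h1 : 0 ≤ Real.sinh a := Real.sinh_nonneg_iff.2 ha
  have h2 : 0 ≤ Real.sinh b := Real.sinh_nonneg_iff.2 hb
  rw [key_P]
  have : Real.cosh (a+b) / Real.sinh (a+b) * (4 * Real.sinh a * Real.sinh b * Real.sinh (a+b))
      = 4 * (Real.sinh a * Real.sinh b) * Real.cosh (a+b) := by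
    field_simp
  rw [this, Real.sinh_two_mul, Real.sinh_two_mul, Real.cosh_add]
  nlinarith [mul_nonneg (mul_nonneg h1 h2) (mul_nonneg h1 h2)]

lemma Hm_eq (m lam t s : ℝ) (hS : 0 < m * Real.sinh m)
    (hD : 0 < m * Real.sinh m + lam * (1 - Real.cosh m)) :
    Hm m lam t s = ((if s ≤ t then Real.sinh (m*s) * Real.sinh (m - m*t)
        else Real.sinh (m*t) * Real.sinh (m-m*s)) *
          (m * Real.sinh m + lam * (1 - Real.cosh m)) +
      lam * Real.sinh (m*t) * (Real.sinh m - Real.sinh (m*s) - Real.sinh (m-m*s))) /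
      (m * Real.sinh m * (m * Real.sinh m + lam * (1 - Real.cosh m))) := by
  unfold Hm
  split_ifs
  · congr 1; ring
  · congr 1; ring

theorem stmt_17 (m lam : ℝ) (hm : 0 < m)
    (hlam : 0 < lam) (hlam' : lam < m * Real.sinh m / (Real.cosh m - 1)) :
    ∃ h₂ : ℝ → ℝ, ∃ C₂ : ℝ,
      ContinuousOn h₂ (Icc 0 1) ∧ (∀ t ∈ Ioc (0:ℝ) 1, 0 < h₂ t) ∧ 0 < C₂ ∧
      ∀ t ∈ Icc (0:ℝ) 1, ∀ s ∈ Icc (0:ℝ) 1,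
        h₂ t * Hm m lam 1 s ≤ Hm m lam t s ∧ Hm m lam t s ≤ C₂ * Hm m lam 1 s := by
  have hS : 0 < Real.sinh m := Real.sinh_pos_iff.2 hm
  have hmS : 0 < m * Real.sinh m := mul_pos hm hS
  have hC : 0 < Real.cosh m - 1 := by
    have := Real.one_lt_cosh.2 hm.ne'
    linarith
  have hD : 0 < m * Real.sinh m + lam * (1 - Real.cosh m) := by
    rw [lt_div_iff₀ hC] at hlam'
    linarith
  set K := Real.cosh (m/2) / Real.sinh (m/2) with hK
  have hKpos : 0 < K := div_pos (Real.cosh_pos _) (Real.sinh_pos_iff.2 (by linarith))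
  refine ⟨fun t => Real.sinh (m*t) / Real.sinh m,
    (K * (m * Real.sinh m + lam * (1 - Real.cosh m)) + lam * Real.sinh m) / (lam * Real.sinh m),
    ?_, ?_, by positivity, ?_⟩
  · exact Continuous.continuousOn (by fun_prop)
  · intro t ht
    exact div_pos (Real.sinh_pos_iff.2 (mul_pos hm ht.1)) hS
  intro t ht s hs
  obtain ⟨ht0, ht1⟩ := ht
  obtain ⟨hs0, hs1⟩ := hs
  have hP : Real.sinh (m*s) * Real.sinh (m-m*s) ≤
      K * (Real.sinh m - Real.sinh (m*s) - Real.sinh (m-m*s)) := by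
    have := key_le (m*s/2) ((m-m*s)/2) (by positivity) (by nlinarith) (by linarith)
    have e1 : 2 * (m*s/2) = m*s := by ring
    have e2 : 2 * ((m-m*s)/2) = m-m*s := by ring
    have e3 : m*s/2 + (m-m*s)/2 = m/2 := by ring
    have e4 : m*s + (m-m*s) = m := by ring
    rwa [e1, e2, e3, e4] at this
  have n1 : 0 ≤ Real.sinh (m*s) := Real.sinh_nonneg_iff.2 (by positivity)
  have n2 : 0 ≤ Real.sinh (m*t) := Real.sinh_nonneg_iff.2 (by positivity)
  have n3 : 0 ≤ Real.sinh (m-m*s) := Real.sinh_nonneg_iff.2 (by nlinarith)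
  have n4 : 0 ≤ Real.sinh (m-m*t) := Real.sinh_nonneg_iff.2 (by nlinarith)
  have n5 : Real.sinh (m*t) ≤ Real.sinh m := Real.sinh_le_sinh.2 (by nlinarith)
  rw [Hm_eq m lam t s hmS hD, Hm_eq m lam 1 s hmS hD, if_pos hs1]
  simp only [mul_one, sub_self, Real.sinh_zero, mul_zero, zero_mul, zero_add]
  have hG : 0 ≤ (if s ≤ t then Real.sinh (m*s) * Real.sinh (m - m*t)
        else Real.sinh (m*t) * Real.sinh (m-m*s)) ∧
      (if s ≤ t then Real.sinh (m*s) * Real.sinh (m - m*t)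
        else Real.sinh (m*t) * Real.sinh (m-m*s)) ≤ Real.sinh (m*s) * Real.sinh (m-m*s) := by
    split_ifs with h
    · exact ⟨by positivity, mul_le_mul_of_nonneg_left
        (Real.sinh_le_sinh.2 (by nlinarith)) n1⟩
    · exact ⟨by positivity, mul_le_mul_of_nonneg_right
        (Real.sinh_le_sinh.2 (by nlinarith)) n3⟩
  obtain ⟨hG0, hG1⟩ := hG
  generalize (if s ≤ t then Real.sinh (m*s) * Real.sinh (m - m*t)
        else Real.sinh (m*t) * Real.sinh (m-m*s)) = G at *
  have hGP := hG1.trans hP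
  have hP0 : 0 ≤ Real.sinh m - Real.sinh (m*s) - Real.sinh (m-m*s) :=
    nonneg_of_mul_nonneg_right (hG0.trans hGP) hKpos
  generalize Real.sinh m - Real.sinh (m*s) - Real.sinh (m-m*s) = P at *
  generalize m * Real.sinh m + lam * (1 - Real.cosh m) = D at *
  rw [← mul_div_assoc, ← mul_div_assoc]
  constructor
  · refine div_le_div_of_nonneg_right ?_ (by positivity)
    have : Real.sinh (m*t) / Real.sinh m * (lam * Real.sinh m * P)
        = lam * Real.sinh (m*t) * P := by field_simp
    rw [this]
    nlinarith [mul_nonneg hG0 hD.le]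
  · refine div_le_div_of_nonneg_right ?_ (by positivity)
    have : (K * D + lam * Real.sinh m) / (lam * Real.sinh m) * (lam * Real.sinh m * P)
        = (K * D + lam * Real.sinh m) * P := by field_simp
    rw [this]
    nlinarith [mul_le_mul_of_nonneg_right hGP hD.le,
      mul_le_mul_of_nonneg_right n5 (mul_nonneg hlam.le hP0)]
end
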